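/- There exists d₀ such that the following holds. Let d ≥ d₀, n ≥ 100d², α ∈ (0, 1), (10 log log d)/(α log d) < γ < α/4, ε ∈ (0, 1/2), and suppose 2/(εγ) < d^{1−α}. Suppose D is an (ε, δ) oblivious subspace embedding over real m×n matrices for d-dimensional subspaces with δ ≤ 1/100, such that every matrix in the support of D has at most s non-zero entries in each column. If m < d^{1+γ}, then s ≥ (α/γ − 4)(1−ε)² / ((16+α)ε); in particular s = Ω(α/(εγ)). -/

import Mathlib

open MeasureTheory ProbabilityTheory

/-- The Euclidean (ℓ₂) norm of a vector in `Fin k → ℝ`. -/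
noncomputable def l2norm {k : ℕ} (v : Fin k → ℝ) : ℝ := Real.sqrt (∑ i, (v i) ^ 2)

instance matrixMeasurableSpace {m n : ℕ} : MeasurableSpace (Matrix (Fin m) (Fin n) ℝ) :=
  (inferInstance : MeasurableSpace (Fin m → Fin n → ℝ))

/-- `D` is an `(ε, δ)` oblivious subspace embedding distribution over real `m × n`
matrices for `d`-dimensional subspaces of `ℝⁿ`. -/
def IsOSE {m n : ℕ} (d : ℕ) (ε δ : ℝ) (D : Measure (Matrix (Fin m) (Fin n) ℝ)) : Prop :=
  ∀ W : Submodule ℝ (Fin n → ℝ), Module.finrank ℝ W = d →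
    ENNReal.ofReal (1 - δ) ≤
      D {Φ | ∀ x ∈ W, (1 - ε) * l2norm x ≤ l2norm (Φ.mulVec x) ∧
               l2norm (Φ.mulVec x) ≤ (1 + ε) * l2norm x}

/-- Every matrix in the (a.e.) support of `D` has at most `s` non-zero entries per column. -/
def ColSparse {m n : ℕ} (s : ℕ) (D : Measure (Matrix (Fin m) (Fin n) ℝ)) : Prop :=
  ∀ᵐ Φ ∂D, ∀ j : Fin n, (Finset.univ.filter fun i : Fin m => Φ i j ≠ 0).card ≤ s


theorem sum_piFinset_apply {ι X : Type*} [Fintype ι] [DecidableEq ι] [DecidableEq X]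
    (c : Finset X) (i : ι) (F : X → ℝ) :
    (c.card : ℝ) * ∑ f ∈ Fintype.piFinset (fun _ : ι => c), F (f i) =
      (c.card : ℝ) ^ Fintype.card ι * ∑ x ∈ c, F x := by
  have h : ∑ f ∈ Fintype.piFinset (fun _ : ι => c), F (f i) =
      (∑ x ∈ c, F x) * (c.card : ℝ) ^ (Fintype.card ι - 1) := by
    have := Finset.prod_univ_sum (fun _ : ι => c) (fun l x => if l = i then F x else (1 : ℝ))
    rw [← Finset.mul_prod_erase _ _ (Finset.mem_univ i)] at this
    simp only [if_true] at this
    have h2 : ∏ l ∈ Finset.univ.erase i, ∑ x ∈ c, (if l = i then F x else (1 : ℝ)) =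
        (c.card : ℝ) ^ (Fintype.card ι - 1) := by
      rw [Finset.prod_congr rfl (g := fun _ => (c.card : ℝ))]
      · simp [Finset.card_erase_of_mem, Finset.card_univ]
      · intro l hl
        simp [Finset.ne_of_mem_erase hl]
    rw [h2] at this
    rw [this]
    refine Finset.sum_congr rfl fun f _ => ?_
    simp
  have hpos : Fintype.card ι = (Fintype.card ι - 1) + 1 := by
    have : 0 < Fintype.card ι := Fintype.card_pos_iff.mpr ⟨i⟩
    omega
  rw [h]
  conv_rhs => rw [hpos, pow_succ]
  ring

theorem sum_piFinset_apply_apply {ι X : Type*} [Fintype ι] [DecidableEq ι] [DecidableEq X]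
    (c : Finset X) {i j : ι} (hij : i ≠ j) (F : X → X → ℝ) :
    (c.card : ℝ) ^ 2 * ∑ f ∈ Fintype.piFinset (fun _ : ι => c), F (f i) (f j) =
      (c.card : ℝ) ^ Fintype.card ι * ∑ x ∈ c, ∑ y ∈ c, F x y := by
  have hcard : 2 ≤ Fintype.card ι := by
    have := Finset.card_le_univ ({i, j} : Finset ι)
    rwa [Finset.card_pair hij] at this
  have h : ∀ x ∈ c, ∑ f ∈ Fintype.piFinset (fun _ : ι => c), (if f i = x then F x (f j) else 0) =
      (∑ y ∈ c, F x y) * (c.card : ℝ) ^ (Fintype.card ι - 2) := by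
    intro x hx
    have := Finset.prod_univ_sum (fun _ : ι => c)
      (fun l z => if l = i then (if z = x then (1 : ℝ) else 0) else if l = j then F x z else 1)
    rw [← Finset.mul_prod_erase _ _ (Finset.mem_univ i),
      ← Finset.mul_prod_erase _ _ (Finset.mem_erase.mpr ⟨hij.symm, Finset.mem_univ j⟩)] at this
    simp only [if_true, hij.symm, if_false] at this
    have h2 : ∏ l ∈ (Finset.univ.erase i).erase j, ∑ z ∈ c,
        (if l = i then (if z = x then (1 : ℝ) else 0) else if l = j then F x z else 1) =
        (c.card : ℝ) ^ (Fintype.card ι - 2) := by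
      rw [Finset.prod_congr rfl (g := fun _ => (c.card : ℝ))]
      · rw [Finset.prod_const, Finset.card_erase_of_mem
          (Finset.mem_erase.mpr ⟨hij.symm, Finset.mem_univ j⟩),
          Finset.card_erase_of_mem (Finset.mem_univ i), Finset.card_univ]
        rfl
      · intro l hl
        have h3 := Finset.ne_of_mem_erase hl
        have h4 := Finset.ne_of_mem_erase (Finset.mem_of_mem_erase hl)
        simp [h3, h4]
    rw [h2] at this
    simp only [Finset.sum_ite_eq', hx, if_true, one_mul] at this
    rw [this]
    refine Finset.sum_congr rfl fun f _ => ?_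
    rw [← Finset.mul_prod_erase _ _ (Finset.mem_univ i),
      ← Finset.mul_prod_erase _ _ (Finset.mem_erase.mpr ⟨hij.symm, Finset.mem_univ j⟩)]
    rw [Finset.prod_eq_one]
    · simp [hij.symm]
    · intro l hl
      have h3 := Finset.ne_of_mem_erase hl
      have h4 := Finset.ne_of_mem_erase (Finset.mem_of_mem_erase hl)
      simp [h3, h4]
  have h5 : ∑ f ∈ Fintype.piFinset (fun _ : ι => c), F (f i) (f j) =
      ∑ x ∈ c, ∑ f ∈ Fintype.piFinset (fun _ : ι => c), (if f i = x then F x (f j) else 0) := by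
    rw [Finset.sum_comm]
    refine Finset.sum_congr rfl fun f hf => ?_
    rw [Finset.sum_ite_eq, if_pos (Fintype.mem_piFinset.mp hf i)]
  rw [h5, Finset.sum_congr rfl h, ← Finset.sum_mul]
  have hpos : Fintype.card ι = (Fintype.card ι - 2) + 2 := by omega
  conv_rhs => rw [hpos, pow_add]
  ring

/-- If a bounded kernel has large average on a finset, then many injective tuples have a large
off-diagonal sum. -/
theorem card_injective_tuples_large {X : Type*} [DecidableEq X] (c : Finset X) (B : X → X → ℝ)
    {k : ℕ} (hk : 2 ≤ k) {ε θ : ℝ} (hε : 0 < ε)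
    (hB : ∀ x ∈ c, ∀ y ∈ c, B x y ≤ 9 / 4)
    (hsum : (c.card : ℝ) ^ 2 * θ ≤ ∑ x ∈ c, ∑ y ∈ c, B x y)
    (hc : 9 * ((k : ℝ) ^ 2 + 1) ≤ c.card * θ) (hkθ : 8 * ε ≤ (k - 1) * θ) :
    (c.card : ℝ) ^ k * θ / 9 ≤
      (((Fintype.piFinset (fun _ : Fin k => c)).filter fun x => Function.Injective x ∧
        4 * ε * k < ∑ p ∈ (Finset.univ : Finset (Fin k)).offDiag, B (x p.1) (x p.2)).card : ℝ) := by
  classical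
  set F : X → X → ℝ := fun x y => if x = y then -(9 / 4 * (k : ℝ) ^ 2) else B x y with hF
  have hk' : (2 : ℝ) ≤ k := by exact_mod_cast hk
  have hg : (0 : ℝ) < c.card := by
    rcases Nat.eq_zero_or_pos c.card with h | h
    · rw [h] at hc; norm_num at hc; nlinarith
    · exact_mod_cast h
  have hθ : 0 < θ := by
    by_contra h
    push Not at h
    nlinarith [mul_nonneg (show (0:ℝ) ≤ k - 1 by linarith) (neg_nonneg.mpr h)]
  set O := (Finset.univ : Finset (Fin k)).offDiag with hO
  have hOcard : (O.card : ℝ) = k * (k - 1) := by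
    rw [hO, Finset.offDiag_card]
    simp only [Finset.card_univ, Fintype.card_fin]
    rw [Nat.cast_sub (by nlinarith)]
    push_cast; ring
  set S : (Fin k → X) → ℝ := fun x => ∑ p ∈ O, F (x p.1) (x p.2) with hS
  set P := Fintype.piFinset (fun _ : Fin k => c) with hP
  have hPcard : (P.card : ℝ) = (c.card : ℝ) ^ k := by
    rw [hP, Fintype.card_piFinset]; simp
  have hFle : ∀ x ∈ c, ∀ y ∈ c, F x y ≤ 9 / 4 := by
    intro x hx y hy
    simp only [hF]
    split_ifs
    · nlinarith
    · exact hB x hx y hy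
  have hinj : ∀ x ∈ P, 0 < S x → Function.Injective x := by
    intro x hx hSx
    by_contra hni
    simp only [Function.Injective, not_forall] at hni
    obtain ⟨i, j, hxij, hij⟩ := hni
    have hmem : (i, j) ∈ O := by simp [hO, hij]
    have h1 : S x = F (x i) (x j) + ∑ p ∈ O.erase (i, j), F (x p.1) (x p.2) :=
      (Finset.add_sum_erase O (fun p => F (x p.1) (x p.2)) hmem).symm
    have h2 : ∑ p ∈ O.erase (i, j), F (x p.1) (x p.2) ≤ (O.erase (i, j)).card • (9 / 4 : ℝ) :=
      Finset.sum_le_card_nsmul _ _ _ fun p _ =>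
        hFle _ (Fintype.mem_piFinset.mp hx _) _ (Fintype.mem_piFinset.mp hx _)
    have h3 : ((O.erase (i, j)).card : ℝ) ≤ O.card := by
      exact_mod_cast Finset.card_erase_le
    have h4 : F (x i) (x j) = -(9 / 4 * (k : ℝ) ^ 2) := by simp [hF, hxij]
    rw [nsmul_eq_mul] at h2
    nlinarith
  have hFsum : (c.card : ℝ) ^ 2 * (3 / 4 * θ) ≤ ∑ x ∈ c, ∑ y ∈ c, F x y := by
    have h1 : ∀ x ∈ c, (∑ y ∈ c, B x y) - 9 / 4 * ((k : ℝ) ^ 2 + 1) ≤ ∑ y ∈ c, F x y := by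
      intro x hx
      rw [← Finset.add_sum_erase c _ hx, ← Finset.add_sum_erase c (fun y => F x y) hx]
      have h2 : ∑ y ∈ c.erase x, F x y = ∑ y ∈ c.erase x, B x y :=
        Finset.sum_congr rfl fun y hy => by simp [hF, (Finset.ne_of_mem_erase hy).symm]
      have h3 : F x x = -(9 / 4 * (k : ℝ) ^ 2) := by simp [hF]
      rw [h2, h3]
      linarith [hB x hx x hx]
    have h2 := Finset.sum_le_sum h1
    rw [Finset.sum_sub_distrib, Finset.sum_const, nsmul_eq_mul] at h2
    nlinarith
  have hSsum : (k : ℝ) * (k - 1) * ((c.card : ℝ) ^ k * (3 / 4 * θ)) ≤ ∑ x ∈ P, S x := by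
    have h1 : (c.card : ℝ) ^ 2 * ∑ x ∈ P, S x =
        k * (k - 1) * ((c.card : ℝ) ^ k * ∑ x ∈ c, ∑ y ∈ c, F x y) := by
      rw [Finset.sum_comm, Finset.mul_sum, ← hOcard, ← nsmul_eq_mul, ← Finset.sum_const]
      refine Finset.sum_congr rfl fun p hp => ?_
      have := sum_piFinset_apply_apply (ι := Fin k) c (Finset.mem_offDiag.mp hp).2.2 F
      rwa [Fintype.card_fin] at this
    have h2 : (k : ℝ) * (k - 1) * ((c.card : ℝ) ^ k * ((c.card : ℝ) ^ 2 * (3 / 4 * θ))) ≤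
        (c.card : ℝ) ^ 2 * ∑ x ∈ P, S x := by
      rw [h1]
      gcongr
      linarith
    have h3 : 0 < (c.card : ℝ) ^ 2 := by positivity
    refine le_of_mul_le_mul_left (le_trans (le_of_eq ?_) h2) h3
    ring
  set Q := P.filter fun x => 4 * ε * k < S x with hQ
  have hQle : Q.card ≤ (P.filter fun x => Function.Injective x ∧
        4 * ε * k < ∑ p ∈ O, B (x p.1) (x p.2)).card := by
    refine Finset.card_le_card fun x hx => ?_
    rw [hQ, Finset.mem_filter] at hx
    have hi := hinj x hx.1 (lt_trans (by positivity) hx.2)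
    refine Finset.mem_filter.mpr ⟨hx.1, hi, ?_⟩
    have : S x = ∑ p ∈ O, B (x p.1) (x p.2) := by
      refine Finset.sum_congr rfl fun p hp => ?_
      have := (Finset.mem_offDiag.mp hp).2.2
      simp [hF, hi.eq_iff, this]
    linarith [hx.2]
  have hupper : ∑ x ∈ P, S x ≤ (c.card : ℝ) ^ k * (4 * ε * k) + Q.card * (9 / 4 * (k * (k - 1))) := by
    have h1 : ∀ x ∈ P, S x ≤ 4 * ε * k + if 4 * ε * k < S x then 9 / 4 * ((k : ℝ) * (k - 1)) else 0 := by
      intro x hx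
      split_ifs with h
      · have : S x ≤ O.card • (9 / 4 : ℝ) := Finset.sum_le_card_nsmul _ _ _ fun p _ =>
          hFle _ (Fintype.mem_piFinset.mp hx _) _ (Fintype.mem_piFinset.mp hx _)
        rw [nsmul_eq_mul, hOcard] at this
        have : 0 < 4 * ε * k := by positivity
        linarith
      · linarith
    refine (Finset.sum_le_sum h1).trans (le_of_eq ?_)
    rw [Finset.sum_add_distrib, Finset.sum_const, nsmul_eq_mul, hPcard, ← Finset.sum_filter,
      Finset.sum_const, nsmul_eq_mul]
  have hfin : (c.card : ℝ) ^ k * θ / 9 ≤ Q.card := by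
    have hgk : (0 : ℝ) < (c.card : ℝ) ^ k := by positivity
    have hkk : (0 : ℝ) < k * (k - 1) := by nlinarith
    have h4 : (c.card : ℝ) ^ k * (4 * ε * k) ≤ (c.card : ℝ) ^ k * (k * ((k - 1) * θ / 2)) := by
      gcongr ?_ * ?_
      nlinarith
    have h5 : (k * (k - 1)) * ((c.card : ℝ) ^ k * θ / 9) ≤ (k * (k - 1) : ℝ) * Q.card := by
      nlinarith
    exact le_of_mul_le_mul_left h5 hkk
  exact hfin.trans (by exact_mod_cast hQle)

theorem exists_disjoint_monochromatic {X Y : Type*} [DecidableEq X] [DecidableEq Y] [Fintype Y]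
    (col : X → Y) {g : ℕ} (hg : 0 < g) (N : ℕ) :
    ∀ A : Finset X, N * g + Fintype.card Y * g ≤ A.card →
      ∃ c : Fin N → Finset X, Pairwise (fun a b => Disjoint (c a) (c b)) ∧
        (∀ a, (c a).card = g) ∧ (∀ a, c a ⊆ A) ∧ ∀ a, ∃ y, ∀ x ∈ c a, col x = y := by
  induction N with
  | zero => exact fun A _ => ⟨fun a => a.elim0, fun a => a.elim0, fun a => a.elim0,
      fun a => a.elim0, fun a => a.elim0⟩
  | succ N ih =>
    intro A hA
    obtain ⟨y, -, hy⟩ := Finset.exists_lt_card_fiber_of_mul_lt_card_of_maps_to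
      (s := A) (t := (Finset.univ : Finset Y)) (f := col) (n := g) (fun _ _ => Finset.mem_univ _)
      (by rw [Finset.card_univ]; nlinarith)
    obtain ⟨c₀, hc₀, hcard⟩ := Finset.exists_subset_card_eq hy.le
    have hc₀A : c₀ ⊆ A := hc₀.trans (Finset.filter_subset _ _)
    obtain ⟨c, hdis, hcg, hcA, hcol⟩ := ih (A \ c₀) (by
      rw [Finset.card_sdiff_of_subset hc₀A, hcard]
      have : (N + 1) * g = N * g + g := by ring
      omega)
    have hd : ∀ a, Disjoint c₀ (c a) := fun a =>
      Finset.disjoint_of_subset_right (hcA a) Finset.disjoint_sdiff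
    refine ⟨Fin.cons c₀ c, ?_, ?_, ?_, ?_⟩
    · intro a b hab
      induction a using Fin.cases with
      | zero =>
        induction b using Fin.cases with
        | zero => exact absurd rfl hab
        | succ b => simpa using hd b
      | succ a =>
        induction b using Fin.cases with
        | zero => simpa using (hd a).symm
        | succ b => simpa using hdis (fun h => hab (by rw [h]))
    · intro a
      induction a using Fin.cases with
      | zero => simpa using hcard
      | succ a => simpa using hcg a
    · intro a
      induction a using Fin.cases with
      | zero => simpa using hc₀A
      | succ a => simpa using (hcA a).trans Finset.sdiff_subset
    · intro a
      induction a using Fin.cases with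
      | zero => exact ⟨y, fun x hx => (Finset.mem_filter.mp (hc₀ (by simpa using hx))).2⟩
      | succ a => simpa using hcol a

theorem sum_univ_apply {ι X : Type*} [Fintype ι] [DecidableEq ι] [Fintype X] [DecidableEq X]
    [Nonempty X] (i : ι) (F : X → ℝ) :
    ∑ f : ι → X, F (f i) = (Fintype.card X : ℝ) ^ Fintype.card ι * ((∑ x, F x) / Fintype.card X) := by
  have h := sum_piFinset_apply (ι := ι) (Finset.univ : Finset X) i F
  have hX : (Fintype.card X : ℝ) ≠ 0 := by simp
  rw [Fintype.piFinset_univ, Finset.card_univ] at h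
  field_simp
  linarith

theorem sum_univ_apply_apply {ι X : Type*} [Fintype ι] [DecidableEq ι] [Fintype X] [DecidableEq X]
    [Nonempty X] {i j : ι} (hij : i ≠ j) (F : X → X → ℝ) :
    ∑ f : ι → X, F (f i) (f j) =
      (Fintype.card X : ℝ) ^ Fintype.card ι * ((∑ x, ∑ y, F x y) / (Fintype.card X : ℝ) ^ 2) := by
  have h := sum_piFinset_apply_apply (ι := ι) (Finset.univ : Finset X) hij F
  have hX : (Fintype.card X : ℝ) ≠ 0 := by simp
  rw [Fintype.piFinset_univ, Finset.card_univ] at h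
  field_simp
  linarith

/-- The number of times `h` takes the value `x`. -/
noncomputable def hitCount {X : Type*} [DecidableEq X] {L : ℕ} (h : Fin L → X) (x : X) : ℝ :=
  ∑ l, if h l = x then 1 else 0

theorem sum_hitCount {X : Type*} [Fintype X] [DecidableEq X] [Nonempty X] (L : ℕ) (x : X) :
    ∑ h : Fin L → X, hitCount h x = (Fintype.card X : ℝ) ^ L * (L / Fintype.card X) := by
  unfold hitCount
  rw [Finset.sum_comm]
  have : ∀ l : Fin L, ∑ h : Fin L → X, (if h l = x then (1 : ℝ) else 0) =
      (Fintype.card X : ℝ) ^ L * (1 / Fintype.card X) := fun l => by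
    rw [sum_univ_apply l (fun y => if y = x then (1 : ℝ) else 0)]
    simp
  simp only [this, Finset.sum_const, Finset.card_univ, Fintype.card_fin, nsmul_eq_mul]
  ring

theorem sum_hitCount_mul_le {X : Type*} [Fintype X] [DecidableEq X] [Nonempty X] (L : ℕ) (x y : X) :
    ∑ h : Fin L → X, hitCount h x * hitCount h y ≤ (Fintype.card X : ℝ) ^ L *
      ((L / Fintype.card X : ℝ) ^ 2 + if x = y then (L / Fintype.card X : ℝ) else 0) := by
  unfold hitCount
  simp only [Finset.sum_mul_sum]
  rw [Finset.sum_comm]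
  simp only [Finset.sum_comm (s := (Finset.univ : Finset (Fin L → X)))]
  have key : ∀ l l' : Fin L, ∑ h : Fin L → X,
      (if h l = x then (1 : ℝ) else 0) * (if h l' = y then (1 : ℝ) else 0) ≤
      (Fintype.card X : ℝ) ^ L * ((1 / Fintype.card X : ℝ) ^ 2 +
        if l = l' then (if x = y then (1 / Fintype.card X : ℝ) else 0) else 0) := by
    intro l l'
    by_cases hl : l = l'
    · subst hl
      rw [sum_univ_apply l (fun z => (if z = x then (1 : ℝ) else 0) * (if z = y then (1 : ℝ) else 0))]
      simp only [Fintype.card_fin, if_true]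
      gcongr
      by_cases hxy : x = y
      · subst hxy
        simp
      · simp [hxy, Ne.symm hxy]
    · rw [sum_univ_apply_apply hl
        (fun z w => (if z = x then (1 : ℝ) else 0) * (if w = y then (1 : ℝ) else 0))]
      simp [hl]
  refine (Finset.sum_le_sum fun l _ => Finset.sum_le_sum fun l' _ => key l l').trans
    (le_of_eq ?_)
  simp only [← Finset.mul_sum, Finset.sum_add_distrib, Finset.sum_const, Finset.card_univ,
    Fintype.card_fin, nsmul_eq_mul, Finset.sum_ite_eq, Finset.mem_univ, if_true]
  split_ifs <;> ring

/-- Second moment bound: if tuples of `P` that share a coordinate lie in a common small block, a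
random `f` contains a transversal tuple of `P` with constant probability. -/
theorem card_exists_transversal {X : Type*} [Fintype X] [DecidableEq X] [Nonempty X] {k L g : ℕ}
    (P : Finset (Fin k → X)) (hk : 0 < k)
    (hP : ∀ x ∈ P, ∃ c : Finset X, c.card ≤ g ∧ ∀ y ∈ P, (∃ i, x i = y i) → ∀ i, y i ∈ c)
    (hg : g * L * k ≤ Fintype.card X)
    (hE : 1 ≤ (P.card : ℝ) * (L / Fintype.card X : ℝ) ^ k) :
    ((Fintype.card X : ℝ) ^ L) ^ k / 4 ≤
      ((Finset.univ.filter fun f : Fin k → Fin L → X =>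
        ∃ x ∈ P, ∀ i, ∃ l, f i l = x i).card : ℝ) := by
  classical
  set q : ℝ := L / Fintype.card X with hq
  set A : ℝ := (Fintype.card X : ℝ) ^ L with hA
  have hX : (0 : ℝ) < Fintype.card X := by exact_mod_cast Fintype.card_pos
  have hq0 : 0 ≤ q := by positivity
  have hA0 : 0 < A := by positivity
  set E : ℝ := P.card * q ^ k with hEdef
  set Z : (Fin k → Fin L → X) → ℝ := fun f => ∑ x ∈ P, ∏ i, hitCount (f i) (x i) with hZ
  set T := (Finset.univ.filter fun f : Fin k → Fin L → X =>
        ∃ x ∈ P, ∀ i, ∃ l, f i l = x i) with hT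
  have hfirst : ∑ f, Z f = A ^ k * E := by
    rw [Finset.sum_comm]
    have : ∀ x ∈ P, ∑ f : Fin k → Fin L → X, ∏ i, hitCount (f i) (x i) = A ^ k * q ^ k := by
      intro x _
      have := Finset.prod_univ_sum (fun _ : Fin k => (Finset.univ : Finset (Fin L → X)))
        (fun i h => hitCount h (x i))
      rw [Fintype.piFinset_univ] at this
      rw [← this]
      simp only [sum_hitCount, Finset.prod_const, Finset.card_univ, Fintype.card_fin]
      rw [mul_pow]
    rw [Finset.sum_congr rfl this, Finset.sum_const, nsmul_eq_mul]
    ring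
  have hpow : (1 + g * q) ^ k ≤ 3 := by
    have h1 : (g : ℝ) * q ≤ 1 / k := by
      have hk' : (0 : ℝ) < k := by exact_mod_cast hk
      rw [hq, le_div_iff₀ hk', mul_div_assoc', div_mul_eq_mul_div, div_le_one hX]
      exact_mod_cast hg
    have h2 : (1 + g * q) ^ k ≤ Real.exp (1 / k) ^ k := by
      gcongr
      linarith [Real.add_one_le_exp (1 / (k : ℝ))]
    rw [← Real.exp_nat_mul, mul_one_div_cancel (by positivity)] at h2
    linarith [Real.exp_one_lt_d9]
  have hsecond : ∑ f, Z f ^ 2 ≤ A ^ k * (E ^ 2 + 3 * E) := by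
    have h1 : ∑ f, Z f ^ 2 = ∑ x ∈ P, ∑ y ∈ P, ∏ i, ∑ h : Fin L → X,
        hitCount h (x i) * hitCount h (y i) := by
      simp only [hZ, sq, Finset.sum_mul_sum]
      rw [Finset.sum_comm]
      refine Finset.sum_congr rfl fun x _ => ?_
      rw [Finset.sum_comm]
      refine Finset.sum_congr rfl fun y _ => ?_
      have := Finset.prod_univ_sum (fun _ : Fin k => (Finset.univ : Finset (Fin L → X)))
        (fun i h => hitCount h (x i) * hitCount h (y i))
      rw [Fintype.piFinset_univ] at this
      rw [this]
      exact Finset.sum_congr rfl fun f _ => Finset.prod_mul_distrib.symm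
    set R : X → X → ℝ := fun x y => q ^ 2 + if x = y then q else 0 with hR
    have hR0 : ∀ x y, 0 ≤ R x y := fun x y => by simp only [hR]; split_ifs <;> positivity
    have h2 : ∀ x ∈ P, ∀ y ∈ P, ∏ i, ∑ h : Fin L → X, hitCount h (x i) * hitCount h (y i) ≤
        A ^ k * ∏ i, R (x i) (y i) := by
      intro x _ y _
      have h0 : ∀ i, 0 ≤ ∑ h : Fin L → X, hitCount h (x i) * hitCount h (y i) := fun i =>
        Finset.sum_nonneg fun h _ => mul_nonneg
          (Finset.sum_nonneg fun l _ => by split_ifs <;> norm_num)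
          (Finset.sum_nonneg fun l _ => by split_ifs <;> norm_num)
      refine (Finset.prod_le_prod (fun i _ => h0 i)
        fun i _ => sum_hitCount_mul_le L (x i) (y i)).trans (le_of_eq ?_)
      rw [Finset.prod_mul_distrib]
      simp [hA, hR, hq]
    have h3 : ∀ x ∈ P, ∑ y ∈ P, ∏ i, R (x i) (y i) ≤ E * q ^ k + 3 * q ^ k := by
      intro x hx
      obtain ⟨c, hcg, hc⟩ := hP x hx
      have h4 : ∀ y ∈ P, ∏ i, R (x i) (y i) ≤ (q ^ 2) ^ k +
          if y ∈ Fintype.piFinset (fun _ : Fin k => c) then ∏ i, R (x i) (y i) else 0 := by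
        intro y hy
        split_ifs with hyc
        · have : 0 ≤ (q ^ 2) ^ k := by positivity
          linarith
        · have hne : ∀ i, x i ≠ y i := fun i hi =>
            hyc (Fintype.mem_piFinset.mpr (hc y hy ⟨i, hi⟩))
          simp [hR, hne]
      have h5 : ∑ y ∈ Fintype.piFinset (fun _ : Fin k => c), ∏ i, R (x i) (y i) ≤ 3 * q ^ k := by
        rw [← Finset.prod_univ_sum (fun _ : Fin k => c) (fun i z => R (x i) z)]
        have h6 : ∀ i, ∑ z ∈ c, R (x i) z ≤ q * (1 + g * q) := by
          intro i
          simp only [hR, Finset.sum_add_distrib, Finset.sum_const, nsmul_eq_mul,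
            Finset.sum_ite_eq]
          have h7 : (c.card : ℝ) * q ^ 2 ≤ g * q ^ 2 := by
            gcongr
          split_ifs <;> nlinarith
        refine (Finset.prod_le_prod (fun i _ => Finset.sum_nonneg fun z _ => hR0 _ _)
          fun i _ => h6 i).trans ?_
        rw [Finset.prod_const, Finset.card_univ, Fintype.card_fin, mul_pow]
        nlinarith [pow_nonneg hq0 k]
      refine (Finset.sum_le_sum h4).trans ?_
      rw [Finset.sum_add_distrib, Finset.sum_const, nsmul_eq_mul, ← Finset.sum_filter]
      have h8 : ∑ y ∈ P with y ∈ Fintype.piFinset (fun _ : Fin k => c), ∏ i, R (x i) (y i) ≤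
          ∑ y ∈ Fintype.piFinset (fun _ : Fin k => c), ∏ i, R (x i) (y i) :=
        Finset.sum_le_sum_of_subset_of_nonneg (fun y hy => (Finset.mem_filter.mp hy).2)
          fun y _ _ => Finset.prod_nonneg fun i _ => hR0 _ _
      have h9 : (P.card : ℝ) * (q ^ 2) ^ k = E * q ^ k := by rw [hEdef]; ring
      linarith
    rw [h1]
    calc _ ≤ ∑ x ∈ P, ∑ y ∈ P, A ^ k * ∏ i, R (x i) (y i) :=
          Finset.sum_le_sum fun x hx => Finset.sum_le_sum fun y hy => h2 x hx y hy
      _ ≤ ∑ x ∈ P, A ^ k * (E * q ^ k + 3 * q ^ k) := by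
          refine Finset.sum_le_sum fun x hx => ?_
          rw [← Finset.mul_sum]
          have := h3 x hx
          gcongr
      _ = _ := by rw [Finset.sum_const, nsmul_eq_mul, hEdef]; ring
  have hzero : ∀ f ∉ T, Z f = 0 := by
    intro f hf
    refine Finset.sum_eq_zero fun x hx => ?_
    have : ∃ i, ∀ l, f i l ≠ x i := by
      by_contra hcon
      push Not at hcon
      exact hf (Finset.mem_filter.mpr ⟨Finset.mem_univ _, x, hx, hcon⟩)
    obtain ⟨i, hi⟩ := this
    exact Finset.prod_eq_zero (Finset.mem_univ i) (Finset.sum_eq_zero fun l _ => by simp [hi l])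
  have hcs : (∑ f, Z f) ^ 2 ≤ T.card * ∑ f, Z f ^ 2 := by
    have h1 : ∑ f, Z f = ∑ f ∈ T, Z f :=
      (Finset.sum_subset (Finset.subset_univ T) fun f _ hf => hzero f hf).symm
    rw [h1]
    refine sq_sum_le_card_mul_sum_sq.trans ?_
    gcongr
    exact Finset.subset_univ _
  rw [hfirst] at hcs
  have hAk : 0 < A ^ k := by positivity
  have h1 : (A ^ k * E) ^ 2 ≤ T.card * (A ^ k * (4 * E ^ 2)) :=
    hcs.trans (mul_le_mul_of_nonneg_left
      (hsecond.trans (mul_le_mul_of_nonneg_left (by nlinarith) hAk.le)) (Nat.cast_nonneg _))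
  have h2 : (A ^ k * E ^ 2) * (A ^ k / 4) ≤ (A ^ k * E ^ 2) * T.card := by nlinarith
  exact le_of_mul_le_mul_left h2 (by positivity)

theorem sum_sq_sum_eq {m k : ℕ} (u : Fin k → Fin m → ℝ) :
    ∑ r, (∑ i, u i r) ^ 2 = (∑ i, ∑ r, u i r ^ 2) +
      ∑ p ∈ (Finset.univ : Finset (Fin k)).offDiag, ∑ r, u p.1 r * u p.2 r := by
  have h1 : ∑ r, (∑ i, u i r) ^ 2 =
      ∑ p ∈ (Finset.univ : Finset (Fin k)) ×ˢ Finset.univ, ∑ r, u p.1 r * u p.2 r := by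
    rw [Finset.sum_comm]
    refine Finset.sum_congr rfl fun r _ => ?_
    rw [sq, Finset.sum_mul_sum, Finset.sum_product]
  rw [h1, ← Finset.diag_union_offDiag, Finset.sum_union (Finset.disjoint_diag_offDiag _),
    Finset.sum_diag]
  simp only [sq]

/-- If every column of norm about `1` has a large entry, then with probability more than `1/100`
the span of randomly chosen coordinate vectors is not embedded by the matrix. -/
theorem card_embedded_lt {m n k L g N : ℕ} (Φ : Matrix (Fin m) (Fin n) ℝ) (hk : 2 ≤ k) (hL : 0 < L)
    (hg : 0 < g) (hn : 0 < n) {ε θ : ℝ} (hε : 0 < ε) (hε2 : ε < 1 / 2) (hθ : 0 < θ)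
    (hent : ∀ j, (1 - ε) ^ 2 ≤ ∑ r, Φ r j ^ 2 → ∃ r, θ ≤ Φ r j ^ 2)
    (hkθ : 8 * ε ≤ (k - 1) * θ) (hgθ : 9 * ((k : ℝ) ^ 2 + 1) ≤ g * θ)
    (hm : 8 * m * g ≤ n) (hN : 2 * N * g ≤ n) (hgL : g * L * k ≤ n)
    (hE : 1 ≤ N * ((g : ℝ) ^ k * θ / 9) * (L / n : ℝ) ^ k)
    (S : Finset (Fin k → Fin L → Fin n))
    (hS : ∀ f ∈ S, ∀ w : Fin n → ℝ, (∀ j, w j ≠ 0 → ∃ i l, f i l = j) →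
      (1 - ε) ^ 2 * ∑ j, w j ^ 2 ≤ ∑ r, Φ.mulVec w r ^ 2 ∧
        ∑ r, Φ.mulVec w r ^ 2 ≤ (1 + ε) ^ 2 * ∑ j, w j ^ 2) :
    (S.card : ℝ) < 99 / 100 * ((n : ℝ) ^ L) ^ k := by
  classical
  by_contra! hcard
  have : Nonempty (Fin n) := ⟨⟨0, hn⟩⟩
  have hn' : (0 : ℝ) < n := by exact_mod_cast hn
  set G := Finset.univ.filter fun j : Fin n =>
    (1 - ε) ^ 2 ≤ ∑ r, Φ r j ^ 2 ∧ ∑ r, Φ r j ^ 2 ≤ (1 + ε) ^ 2 with hG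
  have hGcard : 99 / 100 * (n : ℝ) ≤ G.card := by
    have h1 : S ⊆ Finset.univ.filter fun f : Fin k → Fin L → Fin n =>
        f ⟨0, by omega⟩ ⟨0, hL⟩ ∈ G := by
      intro f hf
      have := hS f hf (Pi.single (f ⟨0, by omega⟩ ⟨0, hL⟩) 1) (fun j hj => by
        refine ⟨⟨0, by omega⟩, ⟨0, hL⟩, ?_⟩
        by_contra hne
        exact hj (Pi.single_eq_of_ne (Ne.symm hne) _))
      simpa [hG, Pi.single_apply] using this
    have h2 : ((Finset.univ.filter fun f : Fin k → Fin L → Fin n =>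
        f ⟨0, by omega⟩ ⟨0, hL⟩ ∈ G).card : ℝ) = ((n : ℝ) ^ L) ^ k * (G.card / n) := by
      rw [Finset.card_filter]
      push_cast
      rw [sum_univ_apply (⟨0, by omega⟩ : Fin k)
        (fun h : Fin L → Fin n => if h ⟨0, hL⟩ ∈ G then (1 : ℝ) else 0),
        sum_univ_apply (⟨0, hL⟩ : Fin L) (fun z : Fin n => if z ∈ G then (1 : ℝ) else 0)]
      simp only [Fintype.card_fun, Fintype.card_fin, Nat.cast_pow, Finset.sum_ite_mem,
        Finset.univ_inter, Finset.sum_const, nsmul_eq_mul, mul_one]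
      field_simp
    have h3 : (S.card : ℝ) ≤ ((n : ℝ) ^ L) ^ k * (G.card / n) := by
      rw [← h2]
      exact_mod_cast Finset.card_le_card h1
    have h4 : ((n : ℝ) ^ L) ^ k * (99 / 100) ≤ ((n : ℝ) ^ L) ^ k * (G.card / n) := by linarith
    have h5 := le_of_mul_le_mul_left h4 (by positivity)
    rwa [le_div_iff₀ hn'] at h5
  have hcol : ∀ j, ∃ y : Option (Fin m × Bool), j ∈ G →
      ∃ r b, y = some (r, b) ∧ θ ≤ Φ r j ^ 2 ∧ (b = true ↔ 0 ≤ Φ r j) := by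
    intro j
    by_cases hj : j ∈ G
    · obtain ⟨r, hr⟩ := hent j (Finset.mem_filter.mp hj).2.1
      exact ⟨some (r, decide (0 ≤ Φ r j)), fun _ => ⟨r, _, rfl, hr, by simp⟩⟩
    · exact ⟨none, fun h => absurd h hj⟩
  choose col hcol using hcol
  have hm1 : 0 < m := by
    have : G.Nonempty := by
      rw [← Finset.card_pos]
      have : (0 : ℝ) < G.card := by linarith
      exact_mod_cast this
    obtain ⟨j, hj⟩ := this
    obtain ⟨r, -⟩ := hcol j hj
    exact r.pos
  obtain ⟨c, hdis, hcg, hcG, hcc⟩ := exists_disjoint_monochromatic col hg N G (by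
    have h1 : Fintype.card (Option (Fin m × Bool)) = 2 * m + 1 := by
      simp [mul_comm]
    rw [h1]
    have h2 : N * g + (2 * m + 1) * g ≤ N * g + 3 * m * g := by nlinarith
    have h3 : (8 * (N * g + 3 * m * g) : ℝ) ≤ 7 * n := by
      have h4 : (2 * N * g : ℝ) ≤ n := by exact_mod_cast hN
      have h5 : (8 * m * g : ℝ) ≤ n := by exact_mod_cast hm
      linarith
    have h6 : ((N * g + 3 * m * g : ℕ) : ℝ) ≤ G.card := by
      push_cast
      linarith
    exact h2.trans (by exact_mod_cast h6))
  set B : Fin n → Fin n → ℝ := fun x y => ∑ r, Φ r x * Φ r y with hBdef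
  set Q : Fin N → Finset (Fin k → Fin n) := fun a =>
    (Fintype.piFinset (fun _ : Fin k => c a)).filter fun x => Function.Injective x ∧
        4 * ε * k < ∑ p ∈ (Finset.univ : Finset (Fin k)).offDiag, B (x p.1) (x p.2) with hQ
  have hQcard : ∀ a, (g : ℝ) ^ k * θ / 9 ≤ (Q a).card := by
    intro a
    have hmem : ∀ x ∈ c a, ∑ r, Φ r x ^ 2 ≤ 9 / 4 := by
      intro x hx
      have := (Finset.mem_filter.mp (hcG a hx)).2.2
      nlinarith
    have := card_injective_tuples_large (c a) B hk (θ := θ) hε ?_ ?_ ?_ hkθ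
    · rwa [hcg a] at this
    · intro x hx y hy
      have h1 : B x y ≤ ∑ r, (Φ r x ^ 2 + Φ r y ^ 2) / 2 :=
        Finset.sum_le_sum fun r _ => by nlinarith [sq_nonneg (Φ r x - Φ r y)]
      rw [← Finset.sum_div, Finset.sum_add_distrib] at h1
      linarith [hmem x hx, hmem y hy]
    · have h1 : ∑ x ∈ c a, ∑ y ∈ c a, B x y = ∑ r, (∑ x ∈ c a, Φ r x) ^ 2 := by
        simp only [hBdef, sq, Finset.sum_mul_sum]
        rw [Finset.sum_comm (s := Finset.univ)]
        exact Finset.sum_congr rfl fun x _ => Finset.sum_comm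
      obtain ⟨y, hy⟩ := hcc a
      obtain ⟨x₀, hx₀⟩ : (c a).Nonempty := by rw [← Finset.card_pos, hcg a]; exact hg
      obtain ⟨r, b, hrb, -, -⟩ := hcol x₀ (hcG a hx₀)
      rw [hy x₀ hx₀] at hrb
      have h2 : ∀ x ∈ c a, θ ≤ Φ r x ^ 2 ∧ (b = true ↔ 0 ≤ Φ r x) := by
        intro x hx
        obtain ⟨r', b', h3, h4, h5⟩ := hcol x (hcG a hx)
        rw [hy x hx, hrb] at h3
        simp only [Option.some.injEq, Prod.mk.injEq] at h3
        rw [h3.1, h3.2]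
        exact ⟨h4, h5⟩
      have h3 : ((c a).card : ℝ) ^ 2 * θ ≤ (∑ x ∈ c a, Φ r x) ^ 2 := by
        have h4 : ((c a).card : ℝ) * √θ ≤ |∑ x ∈ c a, Φ r x| := by
          have habs : ∀ x ∈ c a, √θ ≤ |Φ r x| := fun x hx => Real.sqrt_le_iff.mpr
            ⟨abs_nonneg _, by rw [sq_abs]; exact (h2 x hx).1⟩
          have h5 : |∑ x ∈ c a, Φ r x| = ∑ x ∈ c a, |Φ r x| := by
            cases b with
            | true =>
              have h6 : ∀ x ∈ c a, 0 ≤ Φ r x := fun x hx => (h2 x hx).2.mp rfl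
              rw [abs_of_nonneg (Finset.sum_nonneg h6)]
              exact Finset.sum_congr rfl fun x hx => (abs_of_nonneg (h6 x hx)).symm
            | false =>
              have h6 : ∀ x ∈ c a, Φ r x ≤ 0 := fun x hx => by
                have := (h2 x hx).2
                simp only [Bool.false_eq_true, false_iff, not_le] at this
                exact this.le
              rw [abs_of_nonpos (Finset.sum_nonpos h6), ← Finset.sum_neg_distrib]
              exact Finset.sum_congr rfl fun x hx => (abs_of_nonpos (h6 x hx)).symm
          rw [h5, ← nsmul_eq_mul]
          exact Finset.card_nsmul_le_sum _ _ _ habs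
        have h5 := pow_le_pow_left₀ (by positivity) h4 2
        rwa [mul_pow, Real.sq_sqrt hθ.le, sq_abs] at h5
      rw [h1]
      exact h3.trans (Finset.single_le_sum (f := fun r => (∑ x ∈ c a, Φ r x) ^ 2)
        (fun r _ => sq_nonneg _) (Finset.mem_univ r))
    · rw [hcg a]; exact hgθ
  have hQmem : ∀ a, ∀ x ∈ Q a, ∀ i, x i ∈ c a := fun a x hx =>
    Fintype.mem_piFinset.mp (Finset.mem_filter.mp hx).1
  have hsame : ∀ a b, ∀ x ∈ Q a, ∀ y ∈ Q b, (∃ i, x i = y i) → a = b := by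
    rintro a b x hx y hy ⟨i, hi⟩
    by_contra hab
    exact Finset.disjoint_left.mp (hdis hab) (hQmem a x hx i) (hi ▸ hQmem b y hy i)
  set P := Finset.univ.biUnion Q with hP
  have hPcard : (N : ℝ) * ((g : ℝ) ^ k * θ / 9) ≤ P.card := by
    rw [hP, Finset.card_biUnion]
    · push_cast
      have := Finset.card_nsmul_le_sum (Finset.univ : Finset (Fin N))
        (fun a => ((Q a).card : ℝ)) _ fun a _ => hQcard a
      rwa [Finset.card_univ, Fintype.card_fin, nsmul_eq_mul] at this
    · intro a _ b _ hab
      exact Finset.disjoint_left.mpr fun x hx hx' =>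
        hab (hsame a b x hx x hx' ⟨⟨0, by omega⟩, rfl⟩)
  have htr := card_exists_transversal (k := k) (L := L) (g := g) P (by omega) (by
      intro x hx
      obtain ⟨a, -, hxa⟩ := Finset.mem_biUnion.mp hx
      refine ⟨c a, (hcg a).le, fun y hy hxy => ?_⟩
      obtain ⟨b, -, hyb⟩ := Finset.mem_biUnion.mp hy
      obtain rfl := hsame a b x hxa y hyb hxy
      exact hQmem a y hyb) (by simpa using hgL) (by
      rw [Fintype.card_fin]
      exact hE.trans (by gcongr))
  rw [Fintype.card_fin] at htr
  set T := Finset.univ.filter fun f : Fin k → Fin L → Fin n => ∃ x ∈ P, ∀ i, ∃ l, f i l = x i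
    with hT
  have hdisj : Disjoint S T := by
    refine Finset.disjoint_left.mpr fun f hfS hfT => ?_
    obtain ⟨x, hxP, hfx⟩ := (Finset.mem_filter.mp hfT).2
    obtain ⟨a, -, hxa⟩ := Finset.mem_biUnion.mp hxP
    obtain ⟨-, hinj, hlarge⟩ := Finset.mem_filter.mp hxa
    have h1 := (hS f hfS (fun j => ∑ i, if x i = j then 1 else 0) (fun j hj => by
      obtain ⟨i, -, hi⟩ := Finset.exists_ne_zero_of_sum_ne_zero hj
      obtain ⟨l, hl⟩ := hfx i
      refine ⟨i, l, ?_⟩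
      by_contra hne
      rw [hl] at hne
      simp [hne] at hi)).2
    have h2 : ∑ j : Fin n, (∑ i, if x i = j then (1 : ℝ) else 0) ^ 2 = k := by
      simp only [sq, Finset.sum_mul_sum]
      rw [Finset.sum_comm]
      rw [Finset.sum_congr rfl fun i _ => Finset.sum_comm]
      simp [hinj.eq_iff]
    have h3 : ∀ r, Φ.mulVec (fun j => ∑ i, if x i = j then (1 : ℝ) else 0) r =
        ∑ i, Φ r (x i) := by
      intro r
      simp only [Matrix.mulVec, dotProduct, Finset.mul_sum]
      rw [Finset.sum_comm]
      simp
    simp only [h3] at h1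
    rw [h2, sum_sq_sum_eq (fun i r => Φ r (x i))] at h1
    have h4 := Finset.card_nsmul_le_sum (Finset.univ : Finset (Fin k))
      (fun i => ∑ r, Φ r (x i) ^ 2) ((1 - ε) ^ 2) fun i _ =>
        (Finset.mem_filter.mp (hcG a (hQmem a x hxa i))).2.1
    rw [Finset.card_univ, Fintype.card_fin, nsmul_eq_mul] at h4
    simp only [hBdef] at hlarge
    nlinarith
  have htot : (S.card : ℝ) + T.card ≤ ((n : ℝ) ^ L) ^ k := by
    have := Finset.card_le_univ (S ∪ T)
    rw [Finset.card_union_of_disjoint hdisj] at this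
    simp only [Fintype.card_fun, Fintype.card_fin] at this
    exact_mod_cast this
  have : 0 < ((n : ℝ) ^ L) ^ k := by positivity
  linarith

theorem div_two_mul_le_natDiv (a b : ℕ) (hb : 0 < b) (hab : (b : ℝ) ≤ a) :
    (a : ℝ) / (2 * b) ≤ ((a / b : ℕ) : ℝ) := by
  have hb' : (0 : ℝ) < b := by exact_mod_cast hb
  have h2 : (a : ℝ) < b * ((a / b : ℕ) + 1) := by exact_mod_cast Nat.lt_mul_div_succ a hb
  have h3 : (1 : ℝ) ≤ ((a / b : ℕ) : ℝ) := by
    exact_mod_cast (Nat.one_le_div_iff hb).mpr (by exact_mod_cast hab)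
  rw [div_le_iff₀ (by positivity)]
  have h4 : (b : ℝ) * 1 ≤ b * ((a / b : ℕ) : ℝ) := by gcongr
  linarith

set_option maxHeartbeats 1000000 in
theorem exists_parameters {d n m : ℕ} {α γ ε : ℝ} (hd : Real.exp (Real.exp 2) ≤ d)
    (hn : 100 * d ^ 2 ≤ n) (hα : α ∈ Set.Ioo (0 : ℝ) 1)
    (hγ : 10 * Real.log (Real.log d) / (α * Real.log d) < γ) (hγα : γ < α / 4)
    (hε : 0 < ε) (hεγ : 2 / (ε * γ) < (d : ℝ) ^ ((1 : ℝ) - α))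
    (hm : (m : ℝ) < (d : ℝ) ^ ((1 : ℝ) + γ)) :
    ∃ k L g N : ℕ, 2 ≤ k ∧ 0 < L ∧ 0 < g ∧ k * L ≤ d ∧
      8 * ε ≤ ((k : ℝ) - 1) * (16 * ε / (α / γ - 4)) ∧
      9 * ((k : ℝ) ^ 2 + 1) ≤ g * (16 * ε / (α / γ - 4)) ∧
      8 * m * g ≤ n ∧ 2 * N * g ≤ n ∧ g * L * k ≤ n ∧
      1 ≤ N * ((g : ℝ) ^ k * (16 * ε / (α / γ - 4)) / 9) * (L / n : ℝ) ^ k := by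
  obtain ⟨hα0, hα1⟩ := hα
  have hd0 : (0 : ℝ) < d := lt_of_lt_of_le (Real.exp_pos _) hd
  have hd1 : (1 : ℝ) ≤ d := le_trans (Real.one_le_exp (Real.exp_pos _).le) hd
  set x := Real.log d with hx
  have hx2 : Real.exp 2 ≤ x := (Real.le_log_iff_exp_le hd0).mpr hd
  have hx0 : 0 < x := lt_of_lt_of_le (Real.exp_pos _) hx2
  set y := Real.log x with hy
  have hy2 : 2 ≤ y := (Real.le_log_iff_exp_le hx0).mpr hx2
  have hx3 : 3 ≤ x := by linarith [Real.add_one_le_exp (2 : ℝ)]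
  have hγ0 : 0 < γ := lt_trans (by positivity) hγ
  have hpow : ∀ t : ℝ, (d : ℝ) ^ t = Real.exp (x * t) := fun t => Real.rpow_def_of_pos hd0 t
  have hγx : 10 * y < γ * (α * x) := by rwa [div_lt_iff₀ (by positivity)] at hγ
  set K := α / γ with hK
  have hKγ : K * γ = α := div_mul_cancel₀ _ hγ0.ne'
  have hK4 : 4 < K := by rw [hK, lt_div_iff₀ hγ0]; linarith
  set θ := 16 * ε / (K - 4) with hθ
  have hθ0 : 0 < θ := div_pos (by positivity) (by linarith)
  have hθlow : 32 * (d : ℝ) ^ (α - 1) ≤ θ := by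
    have h1 : 16 * (ε * γ) ≤ θ := by
      rw [hθ, le_div_iff₀ (by linarith)]
      nlinarith [mul_pos hε hγ0, mul_pos hε hα0]
    have h2 : 2 * (d : ℝ) ^ (α - 1) < ε * γ := by
      rw [div_lt_iff₀ (by positivity)] at hεγ
      have h3 : (d : ℝ) ^ (α - 1) * (d : ℝ) ^ (1 - α) = 1 := by
        rw [← Real.rpow_add hd0]; simp
      have h4 : 0 < (d : ℝ) ^ (α - 1) := by positivity
      nlinarith
    linarith
  set k := ⌈K / 2 - 1⌉₊ with hk
  have hk1 : K / 2 - 1 ≤ k := Nat.le_ceil _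
  have hk2 : (k : ℝ) < K / 2 := by
    have := Nat.ceil_lt_add_one (a := K / 2 - 1) (by linarith)
    linarith
  have hk3 : 2 ≤ k := by
    have : (1 : ℝ) < k := by linarith
    exact_mod_cast this
  have hk3' : (2 : ℝ) ≤ k := by exact_mod_cast hk3
  have hkγ : k * γ < α / 2 := by nlinarith
  have hky : k * (20 * y) < α ^ 2 * x := by
    have h1 : k * (20 * y) < k * (2 * (γ * (α * x))) := by
      have : (0 : ℝ) < k := by linarith
      nlinarith
    have h2 : (k * γ) * (2 * (α * x)) < α / 2 * (2 * (α * x)) :=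
      mul_lt_mul_of_pos_right hkγ (by positivity)
    nlinarith
  have hkx : 32 * (k : ℝ) ≤ x := by
    have h1 : α ^ 2 * x ≤ x := by nlinarith [mul_pos hx0 hα0]
    nlinarith
  have hxd : x ≤ d := by linarith [Real.log_le_sub_one_of_pos hd0]
  have hkd : (k : ℝ) ≤ d := by linarith
  set M := ⌊(d : ℝ) ^ ((1 : ℝ) + γ)⌋₊ with hM
  have hpd : (d : ℝ) ≤ (d : ℝ) ^ ((1 : ℝ) + γ) := by
    conv_lhs => rw [← Real.rpow_one (d : ℝ)]
    exact Real.rpow_le_rpow_of_exponent_le hd1 (by linarith)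
  have hMm : m ≤ M := Nat.le_floor hm.le
  have hMd : d ≤ M := Nat.le_floor hpd
  have hMle : (M : ℝ) ≤ (d : ℝ) ^ ((1 : ℝ) + γ) := Nat.floor_le (by positivity)
  have hM1 : (1 : ℝ) ≤ M := hd1.trans (by exact_mod_cast hMd)
  have hnd : 100 * (d : ℝ) ^ 2 ≤ n := by exact_mod_cast hn
  have hMd2 : (M : ℝ) ≤ (d : ℝ) ^ 2 := by
    refine hMle.trans ?_
    rw [← Real.rpow_natCast]
    exact Real.rpow_le_rpow_of_exponent_le hd1 (by push_cast; linarith)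
  have hn0 : (0 : ℝ) < n := by linarith [pow_pos hd0 2]
  have hMpos : 0 < M := by exact_mod_cast (lt_of_lt_of_le one_pos hM1)
  set L := d / k with hL
  set g := n / (8 * M) with hg
  set N := n / (2 * g) with hN
  have hg1 : (n : ℝ) / (16 * M) ≤ g := by
    have := div_two_mul_le_natDiv n (8 * M) (by positivity) (by push_cast; linarith [pow_pos hd0 2])
    refine le_trans (le_of_eq ?_) this
    push_cast; ring
  have hgM : 8 * M * g ≤ n := by
    rw [hg]; exact Nat.mul_div_le n (8 * M)
  have hgM' : 8 * (M : ℝ) * g ≤ n := by exact_mod_cast hgM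
  have hg0' : (0 : ℝ) < g := lt_of_lt_of_le (by positivity) hg1
  have hg0 : 0 < g := by exact_mod_cast hg0'
  have hL1 : (d : ℝ) / (2 * k) ≤ L := div_two_mul_le_natDiv d k (by omega) hkd
  have hL0' : (0 : ℝ) < L := lt_of_lt_of_le (by positivity) hL1
  have hL0 : 0 < L := by exact_mod_cast hL0'
  have hkL : k * L ≤ d := Nat.mul_div_le d k
  have hN1 : (n : ℝ) / (4 * g) ≤ N := by
    have := div_two_mul_le_natDiv n (2 * g) (by positivity) (by
      push_cast; linarith [mul_le_mul_of_nonneg_right hM1 hg0'.le])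
    refine le_trans (le_of_eq ?_) this
    push_cast; ring
  have hNM : 2 * (M : ℝ) ≤ N := by
    refine le_trans ?_ hN1
    rw [le_div_iff₀ (by positivity)]
    linarith
  have hNg : 2 * N * g ≤ n := by
    have := Nat.mul_div_le n (2 * g)
    calc 2 * N * g = 2 * g * N := by ring
      _ ≤ n := this
  refine ⟨k, L, g, N, hk3, hL0, hg0, hkL, ?_, ?_, ?_, hNg, ?_, ?_⟩
  · rw [hθ, mul_div_assoc', le_div_iff₀ (by linarith)]
    linarith [mul_le_mul_of_nonneg_right hk1 hε.le]
  · have h1 : 6 * (d : ℝ) ^ (1 - γ) ≤ g := by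
      refine le_trans ?_ hg1
      rw [le_div_iff₀ (by positivity)]
      have h2 : (d : ℝ) ^ (1 - γ) * (d : ℝ) ^ (1 + γ) = (d : ℝ) ^ 2 := by
        rw [← Real.rpow_add hd0, ← Real.rpow_natCast]; congr 1; push_cast; ring
      have h3 : 0 < (d : ℝ) ^ (1 - γ) := by positivity
      linarith [mul_le_mul_of_nonneg_left hMle h3.le, pow_pos hd0 2]
    have h2 : (6 * (d : ℝ) ^ (1 - γ)) * (32 * (d : ℝ) ^ (α - 1)) ≤ g * θ := by
      gcongr
    have h3 : (d : ℝ) ^ (1 - γ) * (d : ℝ) ^ (α - 1) = (d : ℝ) ^ (α - γ) := by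
      rw [← Real.rpow_add hd0]; congr 1; ring
    have h4 : x ^ 2 ≤ (d : ℝ) ^ (α - γ) := by
      have h5 : x ^ 2 = Real.exp (y * 2) := by
        rw [hy, ← Real.rpow_def_of_pos hx0]; norm_num
      rw [h5, hpow]
      refine Real.exp_le_exp.mpr ?_
      have h6 : γ * (α * x) ≤ γ * x :=
        mul_le_mul_of_nonneg_left (mul_le_of_le_one_left hx0.le hα1.le) hγ0.le
      linarith [mul_le_mul_of_nonneg_left (show 3 * γ ≤ α - γ by linarith) hx0.le,
        mul_pos hγ0 hx0]
    have h5 := pow_le_pow_left₀ (by positivity) hkx 2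
    have h6 := pow_le_pow_left₀ (by norm_num) hx3 2
    have h7 := sq_nonneg (k : ℝ)
    linarith
  · calc 8 * m * g ≤ 8 * M * g := by gcongr
      _ ≤ n := hgM
  · calc g * L * k = g * (k * L) := by ring
      _ ≤ g * M := by gcongr; exact hkL.trans hMd
      _ ≤ n := by
        have h : 8 * M * g = 8 * (g * M) := by ring
        omega
  · have h1 : (d : ℝ) ^ (-γ) / x ≤ g * (L / n) := by
      have h2 : (L : ℝ) / (16 * M) ≤ g * (L / n) := by
        have := mul_le_mul_of_nonneg_right hg1 (show 0 ≤ (L : ℝ) / n by positivity)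
        refine le_trans (le_of_eq ?_) this
        field_simp
      refine le_trans ?_ h2
      have h3 : (d : ℝ) = (d : ℝ) ^ (-γ) * (d : ℝ) ^ (1 + γ) := by
        rw [← Real.rpow_add hd0]; simp
      have h4 : 0 < (d : ℝ) ^ (-γ) := by positivity
      have hk0 : (0 : ℝ) < k := by linarith
      rw [div_le_iff₀ (by positivity)] at hL1
      rw [div_le_div_iff₀ hx0 (by positivity)]
      have h5 : (d : ℝ) ^ (-γ) * M ≤ d := by
        conv_rhs => rw [h3]
        gcongr
      linarith [mul_le_mul_of_nonneg_left hkx hL0'.le]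
    have h2 : ((d : ℝ) ^ (-γ) / x) ^ k ≤ (g : ℝ) ^ k * (L / n) ^ k := by
      rw [← mul_pow]
      exact pow_le_pow_left₀ (by positivity) h1 k
    have h3 : (d : ℝ) ^ (-α) ≤ ((d : ℝ) ^ (-γ) / x) ^ k := by
      have h4 : x = Real.exp y := (Real.exp_log hx0).symm
      have h5 : (d : ℝ) ^ (-γ) / x = Real.exp (x * -γ - y) := by
        rw [hpow, Real.exp_sub, ← h4]
      rw [h5, hpow, ← Real.exp_nat_mul]
      refine Real.exp_le_exp.mpr ?_
      have h6 : k * γ * x ≤ α / 2 * x :=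
        mul_le_mul_of_nonneg_right hkγ.le hx0.le
      have h7 : α ^ 2 * x ≤ α * x :=
        mul_le_mul_of_nonneg_right (by rw [sq]; exact mul_le_of_le_one_left hα0.le hα1.le) hx0.le
      linarith [mul_pos hx0 hα0]
    have h4 : (d : ℝ) ≤ N := by
      have : (d : ℝ) ≤ M := by exact_mod_cast hMd
      linarith
    have h5 : (d : ℝ) * (d : ℝ) ^ (α - 1) * (d : ℝ) ^ (-α) = 1 := by
      conv_lhs => rw [← Real.rpow_one (d : ℝ)]
      rw [Real.rpow_one, ← Real.rpow_one_add' hd0.le (by linarith), ← Real.rpow_add hd0]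
      simp
    calc (1 : ℝ) ≤ 32 / 9 * 1 := by norm_num
      _ = (d : ℝ) * (32 * (d : ℝ) ^ (α - 1) / 9) * (d : ℝ) ^ (-α) := by
          linear_combination (-32 / 9 : ℝ) * h5
      _ ≤ N * (θ / 9) * ((g : ℝ) ^ k * (L / n) ^ k) := by
          have := h3.trans h2
          gcongr
      _ = _ := by ring

theorem measurableSet_embeds {m n : ℕ} (ε : ℝ) (W : Submodule ℝ (Fin n → ℝ)) :
    MeasurableSet {Φ : Matrix (Fin m) (Fin n) ℝ |
      ∀ x ∈ W, (1 - ε) * l2norm x ≤ l2norm (Φ.mulVec x) ∧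
        l2norm (Φ.mulVec x) ≤ (1 + ε) * l2norm x} := by
  have h : IsClosed {Φ : Fin m → Fin n → ℝ |
      ∀ x ∈ W, (1 - ε) * l2norm x ≤ l2norm (Matrix.mulVec Φ x) ∧
        l2norm (Matrix.mulVec Φ x) ≤ (1 + ε) * l2norm x} := by
    have hc : ∀ x : Fin n → ℝ, Continuous fun Φ : Fin m → Fin n → ℝ =>
        l2norm (Matrix.mulVec Φ x) := by
      intro x
      unfold l2norm Matrix.mulVec dotProduct
      fun_prop
    simp only [Set.ofPred_forall]
    exact isClosed_iInter fun x => isClosed_iInter fun _ =>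
      (isClosed_le continuous_const (hc x)).inter (isClosed_le (hc x) continuous_const)
  exact h.measurableSet

theorem exists_matrix_embedding_many {ι : Type*} [Fintype ι] {m n d s : ℕ} {ε δ : ℝ}
    (D : Measure (Matrix (Fin m) (Fin n) ℝ)) [IsProbabilityMeasure D] (hD : IsOSE d ε δ D)
    (hs : ColSparse s D) (W : ι → Submodule ℝ (Fin n → ℝ)) (hW : ∀ i, Module.finrank ℝ (W i) = d) :
    ∃ (Φ : Matrix (Fin m) (Fin n) ℝ) (S : Finset ι),
      (∀ j : Fin n, (Finset.univ.filter fun i : Fin m => Φ i j ≠ 0).card ≤ s) ∧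
      (∀ i ∈ S, ∀ x ∈ W i, (1 - ε) * l2norm x ≤ l2norm (Φ.mulVec x) ∧
        l2norm (Φ.mulVec x) ≤ (1 + ε) * l2norm x) ∧
      (1 - δ) * Fintype.card ι ≤ S.card := by
  classical
  set E : ι → Set (Matrix (Fin m) (Fin n) ℝ) := fun i =>
    {Φ | ∀ x ∈ W i, (1 - ε) * l2norm x ≤ l2norm (Φ.mulVec x) ∧
      l2norm (Φ.mulVec x) ≤ (1 + ε) * l2norm x} with hE
  have hEm : ∀ i, MeasurableSet (E i) := fun i => measurableSet_embeds ε (W i)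
  set F : Matrix (Fin m) (Fin n) ℝ → ENNReal := fun Φ => ∑ i, (E i).indicator 1 Φ with hF
  have hint : ∫⁻ Φ, F Φ ∂D = ∑ i, D (E i) := by
    rw [lintegral_finsetSum _ fun i _ => measurable_one.indicator (hEm i)]
    exact Finset.sum_congr rfl fun i _ => lintegral_indicator_one (hEm i)
  have hfin : ∫⁻ Φ, F Φ ∂D ≠ ⊤ := by
    rw [hint]
    exact ENNReal.sum_ne_top.mpr fun i _ => measure_ne_top _ _
  obtain ⟨Φ, hΦ, hle⟩ := exists_notMem_null_lintegral_le hfin (ae_iff.mp hs)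
  refine ⟨Φ, Finset.univ.filter fun i => Φ ∈ E i, not_not.mp hΦ,
    fun i hi => (Finset.mem_filter.mp hi).2, ?_⟩
  have h1 : F Φ = ENNReal.ofReal ((Finset.univ.filter fun i => Φ ∈ E i).card : ℝ) := by
    simp only [hF, Set.indicator_apply, Pi.one_apply, Finset.sum_boole, ENNReal.ofReal_natCast]
  have h2 : ENNReal.ofReal ((Fintype.card ι : ℝ) * (1 - δ)) ≤ ∑ i, D (E i) := by
    rw [ENNReal.ofReal_mul (Nat.cast_nonneg _), ENNReal.ofReal_natCast, ← nsmul_eq_mul]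
    exact Finset.card_nsmul_le_sum _ _ _ fun i _ => hD (W i) (hW i)
  rw [← hint] at h2
  have h3 := h2.trans (hle.trans h1.le)
  rw [ENNReal.ofReal_le_ofReal_iff (Nat.cast_nonneg _)] at h3
  linarith

theorem exists_submodule_coordinates {n d : ℕ} (T : Finset (Fin n)) (hT : T.card ≤ d)
    (hd : d ≤ n) : ∃ W : Submodule ℝ (Fin n → ℝ), Module.finrank ℝ W = d ∧
      ∀ w : Fin n → ℝ, (∀ j, w j ≠ 0 → j ∈ T) → w ∈ W := by
  classical
  obtain ⟨T', hTT', hcard⟩ := Finset.exists_superset_card_eq hT (by simpa using hd)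
  refine ⟨Submodule.span ℝ (Set.range fun j : T' => (Pi.basisFun ℝ (Fin n)) j), ?_, ?_⟩
  · rw [finrank_span_eq_card]
    · simpa using hcard
    · exact (Pi.basisFun ℝ (Fin n)).linearIndependent.comp _ Subtype.val_injective
  · intro w hw
    rw [← (Pi.basisFun ℝ (Fin n)).sum_repr w]
    refine Submodule.sum_mem _ fun j _ => ?_
    by_cases hj : w j = 0
    · simp [hj]
    · exact Submodule.smul_mem _ _ (Submodule.subset_span ⟨⟨j, hTT' (hw j hj)⟩, rfl⟩)

theorem l2norm_sq {k : ℕ} (v : Fin k → ℝ) : l2norm v ^ 2 = ∑ i, v i ^ 2 :=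
  Real.sq_sqrt (Finset.sum_nonneg fun _ _ => sq_nonneg _)

theorem l2norm_nonneg {k : ℕ} (v : Fin k → ℝ) : 0 ≤ l2norm v := Real.sqrt_nonneg _

theorem stmt11 :
    ∃ d₀ : ℕ,
      ∀ (d n m s : ℕ) (α γ ε δ : ℝ) (D : Measure (Matrix (Fin m) (Fin n) ℝ)),
        IsProbabilityMeasure D →
        d₀ ≤ d → 100 * d ^ 2 ≤ n →
        α ∈ Set.Ioo (0:ℝ) 1 →
        10 * Real.log (Real.log d) / (α * Real.log d) < γ → γ < α / 4 →
        0 < ε → ε < 1/2 →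
        2 / (ε * γ) < (d : ℝ) ^ ((1:ℝ) - α) →
        0 ≤ δ → δ ≤ 1/100 →
        IsOSE d ε δ D →
        ColSparse s D →
        (m : ℝ) < (d : ℝ) ^ ((1:ℝ) + γ) →
        (α / γ - 4) * (1 - ε) ^ 2 / ((16 + α) * ε) ≤ (s : ℝ) := by
  classical
  refine ⟨⌈Real.exp (Real.exp 2)⌉₊, ?_⟩
  intro d n m s α γ ε δ D hprob hd₀ hn hα hγ hγα hε hε2 hεγ _ hδ hOSE hsparse hm
  have hd : Real.exp (Real.exp 2) ≤ d := Nat.ceil_le.mp hd₀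
  have hd0 : 0 < d := by
    have : (0 : ℝ) < d := lt_of_lt_of_le (Real.exp_pos _) hd
    exact_mod_cast this
  have hdn : d ≤ n := by nlinarith
  obtain ⟨k, L, g, N, hk, hL, hg, hkL, hkθ, hgθ, hmg, hNg, hgL, hE⟩ :=
    exists_parameters hd hn hα hγ hγα hε hεγ hm
  by_contra! hlt
  have hγ0 : 0 < γ := by
    refine lt_of_le_of_lt ?_ hγ
    have h1 : Real.exp 2 ≤ Real.log d := (Real.le_log_iff_exp_le (by exact_mod_cast hd0)).mpr hd
    have h2 : 1 ≤ Real.log d := (Real.one_le_exp (by norm_num)).trans h1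
    have h3 := Real.log_nonneg h2
    have := hα.1
    positivity
  have hK : 0 < α / γ - 4 := by
    have : 4 < α / γ := by rw [lt_div_iff₀ hγ0]; linarith
    linarith
  set θ := 16 * ε / (α / γ - 4) with hθ
  have hθ0 : 0 < θ := by positivity
  have hsθ : s * θ < (1 - ε) ^ 2 := by
    rw [lt_div_iff₀ (by have := hα.1; positivity)] at hlt
    rw [hθ, mul_div_assoc', div_lt_iff₀ hK]
    have : 0 ≤ s * (α * ε) := by have := hα.1; positivity
    linarith
  have hcoord : ∀ f : Fin k → Fin L → Fin n, ∃ W : Submodule ℝ (Fin n → ℝ),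
      Module.finrank ℝ W = d ∧
      ∀ w : Fin n → ℝ, (∀ j, w j ≠ 0 → ∃ i l, f i l = j) → w ∈ W := by
    intro f
    obtain ⟨W, hW, hmem⟩ := exists_submodule_coordinates (d := d)
      (Finset.univ.image fun p : Fin k × Fin L => f p.1 p.2)
      (Finset.card_image_le.trans (by simpa using hkL)) hdn
    refine ⟨W, hW, fun w hw => hmem w fun j hj => ?_⟩
    obtain ⟨i, l, hil⟩ := hw j hj
    exact Finset.mem_image.mpr ⟨(i, l), Finset.mem_univ _, hil⟩
  choose W hW hmem using hcoord
  obtain ⟨Φ, S, hΦ, hS, hcard⟩ := exists_matrix_embedding_many D hOSE hsparse W hW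
  have hent : ∀ j, (1 - ε) ^ 2 ≤ ∑ r, Φ r j ^ 2 → ∃ r, θ ≤ Φ r j ^ 2 := by
    intro j hj
    by_contra! hcon
    have h1 : ∑ r, Φ r j ^ 2 = ∑ r with Φ r j ≠ 0, Φ r j ^ 2 := by
      rw [Finset.sum_filter]
      exact Finset.sum_congr rfl fun r _ => by by_cases h : Φ r j = 0 <;> simp [h]
    have h2 := Finset.sum_le_card_nsmul (Finset.univ.filter fun r => Φ r j ≠ 0)
      (fun r => Φ r j ^ 2) θ fun r _ => (hcon r).le
    rw [nsmul_eq_mul] at h2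
    have h3 : ((Finset.univ.filter fun r => Φ r j ≠ 0).card : ℝ) * θ ≤ s * θ := by
      gcongr
      exact hΦ j
    linarith
  have hfinal := card_embedded_lt Φ hk hL hg (by omega) hε hε2 hθ0 hent hkθ hgθ hmg hNg hgL hE S (by
    intro f hf w hw
    obtain ⟨h1, h2⟩ := hS f hf w (hmem f w hw)
    have hw0 := l2norm_nonneg w
    rw [← l2norm_sq, ← l2norm_sq, ← mul_pow, ← mul_pow]
    exact ⟨pow_le_pow_left₀ (mul_nonneg (by linarith) hw0) h1 2,
      pow_le_pow_left₀ (l2norm_nonneg _) h2 2⟩)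
  simp only [Fintype.card_fun, Fintype.card_fin, Nat.cast_pow] at hcard
  have : (0 : ℝ) ≤ ((n : ℝ) ^ L) ^ k := by positivity
  nlinarith
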